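/- Let W be a nonempty word over A^{±1} and suppose B_0, B_1, ..., B_ℓ is a sequence of pseudobracket systems for W (with respect to presentation (1.4)) in which B_0 is empty and each B_{i+1} is obtained from B_i by an elementary operation. Then for every i and every pseudobracket b ∈ B_i, the word W(b(1)..b(2)]·a_1^{-b(3)} is a product of b(4) conjugates of r^{±1} in F(A); in particular W(b(1)..b(2)] = a_1^{b(3)} in G_3. [group-theoretic content of Claim (D1) in the proof of Lemma 6.12] -/

import Mathlib

namespace Stmt12

/-- Words over the alphabet `A^{±1}` where `A = {a_1, a_2, ..., a_{m+2}}` (at least two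
generators; `a_1` is the letter `0` and `a_2` is the letter `1`). -/
abbrev Word (m : ℕ) := List (Fin (m + 2) × Bool)

/-- The image of a word in the free group `F(A)`. -/
def evalW {m : ℕ} (w : Word m) : FreeGroup (Fin (m + 2)) := FreeGroup.mk w

/-- The generator `a_1` as an element of `F(A)`. -/
def a1g (m : ℕ) : FreeGroup (Fin (m + 2)) := FreeGroup.of 0

/-- The Baumslag–Solitar relator `r = a_2 a_1^{n_1} a_2^{-1} a_1^{-n_2}` of the
presentation (1.4). -/
def relBS (m : ℕ) (n1 n2 : ℤ) : FreeGroup (Fin (m + 2)) :=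
  FreeGroup.of 1 * FreeGroup.of 0 ^ n1 * (FreeGroup.of 1)⁻¹ * FreeGroup.of 0 ^ (-n2)

/-- `g` is a product of exactly `n` conjugates of elements of `R ∪ R⁻¹`. -/
def IsProdConj {G : Type*} [Group G] (R : Set G) (n : ℕ) (g : G) : Prop :=
  ∃ r s : Fin n → G,
    (∀ i, r i ∈ R ∨ (r i)⁻¹ ∈ R) ∧
    g = (List.ofFn fun i => s i * r i * (s i)⁻¹).prod

/-- `|U|_{a_1}`: the number of occurrences of `a_1^{±1}` in `U`. -/
def countA1 {m : ℕ} (U : Word m) : ℕ := U.countP fun x => decide (x.1 = (0 : Fin (m + 2)))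

/-- `|U|_{\bar a_1} := |U| - |U|_{a_1}`. -/
def noA1 {m : ℕ} (U : Word m) : ℕ := U.countP fun x => decide (x.1 ≠ (0 : Fin (m + 2)))

/-- The sign `ε = ±1` of a letter. -/
def sgn (ε : Bool) : ℤ := if ε then 1 else -1

/-- A pseudobracket for presentation (1.4): the 4-tuple `(b(1), b(2), b(3), b(4))` of
integers with `b(1), b(2), b(4) ≥ 0`. -/
structure PB where
  c1 : ℕ
  c2 : ℕ
  c3 : ℤ
  c4 : ℕ
deriving DecidableEq

/-- A pseudobracket for the word `W`: `0 ≤ b(1) ≤ b(2) ≤ |W|` and `b(4) ≥ 0`. -/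
def ValidPB {m : ℕ} (W : Word m) (b : PB) : Prop := b.c1 ≤ b.c2 ∧ b.c2 ≤ W.length

/-- A pseudobracket system for `W`: a finite set of pseudobrackets such that for
distinct `b, c` either `b(2) ≤ c(1)` or `c(2) ≤ b(1)`. -/
def IsPBS {m : ℕ} (W : Word m) (B : Finset PB) : Prop :=
  (∀ b ∈ B, ValidPB W b) ∧
    ∀ b ∈ B, ∀ c ∈ B, b ≠ c → b.c2 ≤ c.c1 ∨ c.c2 ≤ b.c1

/-- The elementary operations over pseudobracket systems for `W` with respect to
presentation (1.4): additions, extensions of types 1–3 and mergers; each operation is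
required to produce again a pseudobracket system. -/
inductive Step (m : ℕ) (n1 n2 : ℤ) (W : Word m) : Finset PB → Finset PB → Prop
  | add (B : Finset PB) (v : ℕ) (hv : v ≤ W.length)
      (hnot : (⟨v, v, 0, 0⟩ : PB) ∉ B)
      (hpbs : IsPBS W (insert (⟨v, v, 0, 0⟩ : PB) B)) :
      Step m n1 n2 W B (insert (⟨v, v, 0, 0⟩ : PB) B)
  | ext1L (B : Finset PB) (b b' : PB) (hb : b ∈ B) (ε : Bool) (hl : 1 ≤ b.c1)
      (hlet : W[b.c1 - 1]? = some ((0 : Fin (m + 2)), ε))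
      (hb' : b' = ⟨b.c1 - 1, b.c2, b.c3 + sgn ε, b.c4⟩)
      (hpbs : IsPBS W (insert b' (B.erase b))) :
      Step m n1 n2 W B (insert b' (B.erase b))
  | ext1R (B : Finset PB) (b b' : PB) (hb : b ∈ B) (ε : Bool)
      (hlet : W[b.c2]? = some ((0 : Fin (m + 2)), ε))
      (hb' : b' = ⟨b.c1, b.c2 + 1, b.c3 + sgn ε, b.c4⟩)
      (hpbs : IsPBS W (insert b' (B.erase b))) :
      Step m n1 n2 W B (insert b' (B.erase b))
  | ext2pos (B : Finset PB) (b b' : PB) (hb : b ∈ B) (hl : 1 ≤ b.c1)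
      (hlet1 : W[b.c1 - 1]? = some ((1 : Fin (m + 2)), true))
      (hlet2 : W[b.c2]? = some ((1 : Fin (m + 2)), false))
      (hs : b.c3 ≠ 0) (hdvd : n1 ∣ b.c3)
      (hb' : b' = ⟨b.c1 - 1, b.c2 + 1, b.c3 / n1 * n2, b.c4 + (b.c3 / n1).natAbs⟩)
      (hpbs : IsPBS W (insert b' (B.erase b))) :
      Step m n1 n2 W B (insert b' (B.erase b))
  | ext2neg (B : Finset PB) (b b' : PB) (hb : b ∈ B) (hl : 1 ≤ b.c1)
      (hlet1 : W[b.c1 - 1]? = some ((1 : Fin (m + 2)), false))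
      (hlet2 : W[b.c2]? = some ((1 : Fin (m + 2)), true))
      (hs : b.c3 ≠ 0) (hdvd : n2 ∣ b.c3)
      (hb' : b' = ⟨b.c1 - 1, b.c2 + 1, b.c3 / n2 * n1, b.c4 + (b.c3 / n2).natAbs⟩)
      (hpbs : IsPBS W (insert b' (B.erase b))) :
      Step m n1 n2 W B (insert b' (B.erase b))
  | ext3 (B : Finset PB) (b b' : PB) (hb : b ∈ B) (hs : b.c3 = 0)
      (i : Fin (m + 2)) (ε : Bool) (hi : i ≠ 0) (hl : 1 ≤ b.c1)
      (hlet1 : W[b.c1 - 1]? = some (i, ε)) (hlet2 : W[b.c2]? = some (i, !ε))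
      (hb' : b' = ⟨b.c1 - 1, b.c2 + 1, 0, b.c4⟩)
      (hpbs : IsPBS W (insert b' (B.erase b))) :
      Step m n1 n2 W B (insert b' (B.erase b))
  | merge (B : Finset PB) (b c b' : PB) (hb : b ∈ B) (hc : c ∈ B) (hbc : b ≠ c)
      (hr : b.c2 = c.c1)
      (hb' : b' = ⟨b.c1, c.c2, b.c3 + c.c3, b.c4 + c.c4⟩)
      (hpbs : IsPBS W (insert b' ((B.erase b).erase c))) :
      Step m n1 n2 W B (insert b' ((B.erase b).erase c))

theorem ipc_iff {G : Type*} [Group G] (R : Set G) (n : ℕ) (g : G) :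
    IsProdConj R n g ↔ ∃ L : List (G × G), L.length = n ∧
      (∀ p ∈ L, p.1 ∈ R ∨ p.1⁻¹ ∈ R) ∧ g = (L.map fun p => p.2 * p.1 * p.2⁻¹).prod := by
  constructor
  · rintro ⟨r, s, h, rfl⟩
    refine ⟨List.ofFn fun i => (r i, s i), by simp, ?_, ?_⟩
    · intro p hp
      rw [List.mem_ofFn] at hp
      obtain ⟨i, rfl⟩ := hp
      exact h i
    · rw [List.map_ofFn]; rfl
  · rintro ⟨L, rfl, h, rfl⟩
    refine ⟨fun i => (L.get i).1, fun i => (L.get i).2, fun i => h _ (List.get_mem _ _), ?_⟩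
    congr 1
    conv_lhs => rw [← List.ofFn_get L, List.map_ofFn]
    rfl

theorem ipc_one {G : Type*} [Group G] (R : Set G) : IsProdConj R 0 1 := by
  rw [ipc_iff]; exact ⟨[], by simp⟩

theorem ipc_mul {G : Type*} [Group G] {R : Set G} {n k : ℕ} {g h : G}
    (hg : IsProdConj R n g) (hh : IsProdConj R k h) : IsProdConj R (n + k) (g * h) := by
  rw [ipc_iff] at *
  obtain ⟨L, rfl, h1, rfl⟩ := hg
  obtain ⟨M, rfl, h2, rfl⟩ := hh
  refine ⟨L ++ M, by simp, ?_, by simp⟩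
  intro p hp
  rcases List.mem_append.1 hp with h | h
  · exact h1 p h
  · exact h2 p h

theorem ipc_conj {G : Type*} [Group G] {R : Set G} {n : ℕ} {g : G} (t : G)
    (hg : IsProdConj R n g) : IsProdConj R n (t * g * t⁻¹) := by
  obtain ⟨r, s, h, rfl⟩ := hg
  refine ⟨r, fun i => t * s i, h, ?_⟩
  have := map_list_prod (MulAut.conj t) (List.ofFn fun i => s i * r i * (s i)⁻¹)
  rw [MulAut.conj_apply] at this
  rw [this, List.map_ofFn]
  congr 2
  funext i
  simp [mul_assoc]

theorem ipc_inv {G : Type*} [Group G] {R : Set G} {n : ℕ} {g : G}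
    (hg : IsProdConj R n g) : IsProdConj R n g⁻¹ := by
  rw [ipc_iff] at *
  obtain ⟨L, rfl, h1, rfl⟩ := hg
  refine ⟨(L.map fun p => (p.1⁻¹, p.2)).reverse, by simp, ?_, ?_⟩
  · intro p hp
    simp only [List.mem_reverse, List.mem_map] at hp
    obtain ⟨q, hq, rfl⟩ := hp
    simpa [or_comm] using h1 q hq
  · rw [List.prod_inv_reverse, List.map_reverse, List.map_map, List.map_map]
    congr 3
    funext p
    simp [mul_assoc]

theorem ipc_pow {G : Type*} [Group G] {R : Set G} {x y : G}
    (h : IsProdConj R 1 (x * y⁻¹)) (q : ℤ) :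
    IsProdConj R q.natAbs (x ^ q * y ^ (-q)) := by
  have key : ∀ n : ℕ, IsProdConj R n (x ^ n * (y ^ n)⁻¹) := by
    intro n
    induction n with
    | zero => simpa using ipc_one R
    | succ n ih =>
      have := ipc_mul (ipc_conj (x ^ n) h) ih
      rw [add_comm 1 n] at this
      convert this using 1
      rw [pow_succ x n, pow_succ' y n]
      group
  obtain ⟨n, rfl | rfl⟩ := Int.eq_nat_or_neg q
  · have := key n
    simpa using this
  · have := ipc_conj (x ^ n)⁻¹ (ipc_inv (key n))
    simpa [mul_assoc] using this

theorem ipc_normal {G : Type*} [Group G] {R : Set G} {n : ℕ} {g : G}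
    (hg : IsProdConj R n g) : g ∈ Subgroup.normalClosure R := by
  rw [ipc_iff] at hg
  obtain ⟨L, -, h1, rfl⟩ := hg
  apply Subgroup.list_prod_mem
  intro x hx
  obtain ⟨p, hp, rfl⟩ := List.mem_map.1 hx
  apply Subgroup.normalClosure_normal.conj_mem
  rcases h1 p hp with h | h
  · exact Subgroup.subset_normalClosure h
  · exact (Subgroup.inv_mem_iff _).1 (Subgroup.subset_normalClosure h)

/-- The subword of `W` between two positions, in the free group. -/
def sub {m : ℕ} (W : Word m) (u v : ℕ) : FreeGroup (Fin (m + 2)) := evalW ((W.take v).drop u)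

theorem sub_mul {m : ℕ} (W : Word m) {u v w : ℕ} (h1 : u ≤ v) (h2 : v ≤ w) :
    sub W u w = sub W u v * sub W v w := by
  unfold sub evalW
  rw [FreeGroup.mul_mk]
  congr 1
  have e : W.take w = W.take v ++ (W.take w).drop v := by
    conv_lhs => rw [← List.take_append_drop v (W.take w), List.take_take, min_eq_left h2]
  by_cases hv : v ≤ W.length
  · conv_lhs => rw [e]
    rw [List.drop_append_of_le_length]
    simp; omega
  · rw [List.take_of_length_le (by omega : W.length ≤ w),
      List.take_of_length_le (by omega : W.length ≤ v), List.drop_of_length_le (i := v) (by omega)]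
    simp

theorem sub_one {m : ℕ} (W : Word m) {u : ℕ} {x : Fin (m + 2) × Bool} (h : W[u]? = some x) :
    sub W u (u + 1) = FreeGroup.mk [x] := by
  unfold sub evalW
  congr 1
  obtain ⟨hu, rfl⟩ := List.getElem?_eq_some_iff.1 h
  rw [List.take_succ_eq_append_getElem hu, List.drop_append_of_le_length (by simp; omega),
    List.drop_of_length_le (by simp)]
  rfl

theorem sub_left {m : ℕ} (W : Word m) {u v : ℕ} {x : Fin (m + 2) × Bool} (hu : 1 ≤ u)
    (huv : u ≤ v) (h : W[u - 1]? = some x) :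
    sub W (u - 1) v = FreeGroup.mk [x] * sub W u v := by
  rw [← sub_one W h, Nat.sub_add_cancel hu]
  exact sub_mul W (by omega) huv

theorem sub_right {m : ℕ} (W : Word m) {u v : ℕ} {x : Fin (m + 2) × Bool}
    (huv : u ≤ v) (h : W[v]? = some x) :
    sub W u (v + 1) = sub W u v * FreeGroup.mk [x] := by
  rw [← sub_one W h]
  exact sub_mul W huv (by omega)

theorem mk_letter {m : ℕ} (i : Fin (m + 2)) (ε : Bool) :
    FreeGroup.mk [(i, ε)] = FreeGroup.of i ^ sgn ε := by
  cases ε <;> simp [sgn, FreeGroup.of, FreeGroup.inv_mk, FreeGroup.invRev]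

/-- The invariant carried along a sequence of elementary operations. -/
def Good (m : ℕ) (n1 n2 : ℤ) (W : Word m) (b : PB) : Prop :=
  ValidPB W b ∧ IsProdConj {relBS m n1 n2} b.c4 (sub W b.c1 b.c2 * a1g m ^ (-b.c3))

theorem ipc_rel (m : ℕ) (n1 n2 : ℤ) : IsProdConj {relBS m n1 n2} 1 (relBS m n1 n2) :=
  ⟨fun _ => relBS m n1 n2, fun _ => 1, by simp, by simp⟩

theorem bs_pos (m : ℕ) (n1 n2 q : ℤ) :
    IsProdConj {relBS m n1 n2} q.natAbs
      (FreeGroup.of 1 * a1g m ^ (q * n1) * (FreeGroup.of 1)⁻¹ * a1g m ^ (-(q * n2))) := by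
  have h := ipc_pow (R := {relBS m n1 n2})
    (x := FreeGroup.of 1 * a1g m ^ n1 * (FreeGroup.of 1)⁻¹) (y := a1g m ^ n2)
    (by simpa [relBS, a1g] using ipc_rel m n1 n2) q
  rw [conj_zpow, ← zpow_mul, ← zpow_mul, mul_comm n1, mul_neg, mul_comm n2] at h
  exact h

theorem bs_neg (m : ℕ) (n1 n2 q : ℤ) :
    IsProdConj {relBS m n1 n2} q.natAbs
      ((FreeGroup.of 1)⁻¹ * a1g m ^ (q * n2) * FreeGroup.of 1 * a1g m ^ (-(q * n1))) := by
  have h := ipc_pow (R := {relBS m n1 n2})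
    (x := (FreeGroup.of 1)⁻¹ * a1g m ^ n2 * (FreeGroup.of 1)⁻¹⁻¹) (y := a1g m ^ n1)
    (by
      have := ipc_conj (FreeGroup.of 1)⁻¹ (ipc_inv (ipc_rel m n1 n2))
      convert this using 1
      simp [relBS, a1g, mul_assoc]) q
  rw [conj_zpow, ← zpow_mul, ← zpow_mul, mul_comm n2, mul_neg, mul_comm n1] at h
  simpa using h

theorem step_good {m : ℕ} {n1 n2 : ℤ} {W : Word m} {B C : Finset PB}
    (h : Step m n1 n2 W B C) (hB : ∀ b ∈ B, Good m n1 n2 W b) :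
    ∀ b ∈ C, Good m n1 n2 W b := by
  have gen : ∀ (D : Finset PB) (c : PB), IsPBS W (insert c D) → (∀ b ∈ D, b ∈ B) →
      IsProdConj {relBS m n1 n2} c.c4 (sub W c.c1 c.c2 * a1g m ^ (-c.c3)) →
      ∀ b ∈ insert c D, Good m n1 n2 W b := by
    intro D c hp hD hc b hb
    rcases Finset.mem_insert.1 hb with rfl | hb'
    · exact ⟨hp.1 _ hb, hc⟩
    · exact hB b (hD b hb')
  have er : ∀ c : PB, ∀ b ∈ B.erase c, b ∈ B := fun c b hb => Finset.mem_of_mem_erase hb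
  cases h with
  | add v hv hnot hpbs =>
    refine gen _ _ hpbs (fun _ h => h) ?_
    have : sub W v v = 1 := by
      unfold sub evalW
      rw [List.drop_of_length_le (by simp)]; rfl
    simpa [this] using ipc_one _
  | ext1L b b' hb ε hl hlet hb' hpbs =>
    refine gen _ _ hpbs (er b) ?_
    obtain ⟨⟨hv, -⟩, hg⟩ := hB b hb
    subst hb'
    simp only
    rw [sub_left W hl hv hlet, mk_letter]
    convert ipc_conj (a1g m ^ sgn ε) hg using 1
    simp only [a1g]
    group
  | ext1R b b' hb ε hlet hb' hpbs =>
    refine gen _ _ hpbs (er b) ?_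
    obtain ⟨⟨hv, -⟩, hg⟩ := hB b hb
    subst hb'
    simp only
    rw [sub_right W hv hlet, mk_letter]
    convert hg using 1
    simp only [a1g]
    group
  | ext2pos b b' hb hl hlet1 hlet2 hs hdvd hb' hpbs =>
    refine gen _ _ hpbs (er b) ?_
    obtain ⟨⟨hv, -⟩, hg⟩ := hB b hb
    subst hb'
    simp only
    rw [sub_right W (by omega) hlet2, sub_left W hl hv hlet1, mk_letter, mk_letter]
    have h2 := bs_pos m n1 n2 (b.c3 / n1)
    rw [Int.ediv_mul_cancel hdvd] at h2
    convert ipc_mul (ipc_conj (FreeGroup.of 1) hg) h2 using 1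
    simp [sgn, mul_assoc]
  | ext2neg b b' hb hl hlet1 hlet2 hs hdvd hb' hpbs =>
    refine gen _ _ hpbs (er b) ?_
    obtain ⟨⟨hv, -⟩, hg⟩ := hB b hb
    subst hb'
    simp only
    rw [sub_right W (by omega) hlet2, sub_left W hl hv hlet1, mk_letter, mk_letter]
    have h2 := bs_neg m n1 n2 (b.c3 / n2)
    rw [Int.ediv_mul_cancel hdvd] at h2
    convert ipc_mul (ipc_conj (FreeGroup.of 1)⁻¹ hg) h2 using 1
    simp [sgn, mul_assoc]
  | ext3 b b' hb hs i ε hi hl hlet1 hlet2 hb' hpbs =>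
    refine gen _ _ hpbs (er b) ?_
    obtain ⟨⟨hv, -⟩, hg⟩ := hB b hb
    subst hb'
    simp only
    rw [sub_right W (by omega) hlet2, sub_left W hl hv hlet1, mk_letter, mk_letter]
    rw [hs] at hg
    convert ipc_conj (FreeGroup.of i ^ sgn ε) hg using 1
    cases ε <;> simp [sgn]
  | merge b c b' hb hc hbc hr hb' hpbs =>
    refine gen _ _ hpbs (fun x hx => er b x (Finset.mem_of_mem_erase hx)) ?_
    obtain ⟨⟨hv, -⟩, hg⟩ := hB b hb
    obtain ⟨⟨hv2, -⟩, hg2⟩ := hB c hc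
    subst hb'
    simp only
    rw [sub_mul W hv (hr ▸ hv2)]
    rw [← hr] at hg2
    convert ipc_mul hg (ipc_conj (a1g m ^ b.c3) hg2) using 1
    group

/-- Group-theoretic content of Claim (D1) in the proof of Lemma 6.12: along any
sequence of pseudobracket systems for `W` (with respect to presentation (1.4)) starting
from the empty system and produced by elementary operations, every pseudobracket `b`
satisfies that `W(b(1)..b(2)]·a_1^{-b(3)}` is a product of `b(4)` conjugates of
`r^{±1}` in `F(A)`; in particular `W(b(1)..b(2)] = a_1^{b(3)}` in `G_3`. -/
theorem statement12 (m : ℕ) (n1 n2 : ℤ) (hn1 : n1 ≠ 0) (hn2 : n2 ≠ 0)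
    (W : Word m) (hW : W ≠ [])
    (ℓ : ℕ) (Bs : ℕ → Finset PB) (h0 : Bs 0 = ∅)
    (hstep : ∀ i < ℓ, Step m n1 n2 W (Bs i) (Bs (i + 1))) :
    ∀ i ≤ ℓ, ∀ b ∈ Bs i,
      IsProdConj {relBS m n1 n2} b.c4
        (evalW ((W.take b.c2).drop b.c1) * a1g m ^ (-b.c3)) ∧
      evalW ((W.take b.c2).drop b.c1) * (a1g m ^ b.c3)⁻¹ ∈
        Subgroup.normalClosure {relBS m n1 n2} := by
  have key : ∀ i ≤ ℓ, ∀ b ∈ Bs i, Good m n1 n2 W b := by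
    intro i
    induction i with
    | zero => intro _ b hb; simp [h0] at hb
    | succ i ih => intro hi; exact step_good (hstep i (by omega)) (ih (by omega))
  intro i hi b hb
  have h := (key i hi b hb).2
  refine ⟨h, ?_⟩
  rw [← zpow_neg]
  exact ipc_normal h

end Stmt12
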